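/- Let u : ℝ × ℝ → ℝ be a C² solution of the Born–Infeld equation satisfying the regularity/decay and smallness hypotheses, and let λ(t) = C t/(log t)². Then there exists a constant K > 0 (depending only on C) such that ∫_2^∞ (1/λ(t)) ∫_ℝ sech²(x/λ(t)) ( (∂ₜu)² + (∂ₓu)² )(t,x) dx dt ≤ K ε². -/

import Mathlib

open MeasureTheory Real Filter

/-- Time derivative `∂ₜ u` of a scalar field `u : ℝ × ℝ → ℝ` (first variable is time). -/
noncomputable def ut (u : ℝ × ℝ → ℝ) (t x : ℝ) : ℝ := deriv (fun s => u (s, x)) t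

/-- Space derivative `∂ₓ u`. -/
noncomputable def ux (u : ℝ × ℝ → ℝ) (t x : ℝ) : ℝ := deriv (fun y => u (t, y)) x

/-- `∂ₜ² u`. -/
noncomputable def utt (u : ℝ × ℝ → ℝ) (t x : ℝ) : ℝ := deriv (fun s => ut u s x) t

/-- `∂ₓ² u`. -/
noncomputable def uxx (u : ℝ × ℝ → ℝ) (t x : ℝ) : ℝ := deriv (fun y => ux u t y) x

/-- Mixed derivative `∂²ₜₓ u`. -/
noncomputable def utx (u : ℝ × ℝ → ℝ) (t x : ℝ) : ℝ := deriv (fun s => ux u s x) t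

/-- The Born–Infeld equation in 1+1 dimensions:
`(1 - (∂ₜu)²) ∂ₓ²u + 2 ∂ₓu ∂ₜu ∂²ₜₓu - (1 + (∂ₓu)²) ∂ₜ²u = 0`. -/
def IsBISol (u : ℝ × ℝ → ℝ) : Prop :=
  ∀ t x : ℝ,
    (1 - (ut u t x) ^ 2) * uxx u t x
      + 2 * ux u t x * ut u t x * utx u t x
      - (1 + (ux u t x) ^ 2) * utt u t x = 0

/-- The scaling function `λ(t) = C t / (log t)²`. -/
noncomputable def lam (C t : ℝ) : ℝ := C * t / (Real.log t) ^ 2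

/-- Hyperbolic secant. -/
noncomputable def sech (x : ℝ) : ℝ := 1 / Real.cosh x

/-! ### Regularity of the first derivatives -/

section Derivatives

variable {u : ℝ × ℝ → ℝ}

lemma hasDerivAt_prodMk_const (t x : ℝ) : HasDerivAt (fun s : ℝ => (s, x)) ((1, 0) : ℝ × ℝ) t :=
  (hasDerivAt_id t).prodMk (hasDerivAt_const t x)

lemma hasDerivAt_const_prodMk (t x : ℝ) : HasDerivAt (fun y : ℝ => (t, y)) ((0, 1) : ℝ × ℝ) x :=
  (hasDerivAt_const x t).prodMk (hasDerivAt_id x)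

lemma HasFDerivAt.hasDerivAt_fst {f : ℝ × ℝ → ℝ} {f' : ℝ × ℝ →L[ℝ] ℝ} {t x : ℝ}
    (h : HasFDerivAt f f' (t, x)) : HasDerivAt (fun s => f (s, x)) (f' (1, 0)) t :=
  h.comp_hasDerivAt t (hasDerivAt_prodMk_const t x)

lemma HasFDerivAt.hasDerivAt_snd {f : ℝ × ℝ → ℝ} {f' : ℝ × ℝ →L[ℝ] ℝ} {t x : ℝ}
    (h : HasFDerivAt f f' (t, x)) : HasDerivAt (fun y => f (t, y)) (f' (0, 1)) x :=
  h.comp_hasDerivAt x (hasDerivAt_const_prodMk t x)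

lemma ut_eq_fderiv (hu : ContDiff ℝ 2 u) (t x : ℝ) : ut u t x = fderiv ℝ u (t, x) (1, 0) :=
  ((hu.differentiable (by norm_num)) (t, x)).hasFDerivAt.hasDerivAt_fst.deriv

lemma ux_eq_fderiv (hu : ContDiff ℝ 2 u) (t x : ℝ) : ux u t x = fderiv ℝ u (t, x) (0, 1) :=
  ((hu.differentiable (by norm_num)) (t, x)).hasFDerivAt.hasDerivAt_snd.deriv

lemma contDiff_fderiv_one (hu : ContDiff ℝ 2 u) : ContDiff ℝ 1 (fderiv ℝ u) :=
  hu.fderiv_right (by norm_num)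

lemma hasFDerivAt_fderiv_apply (hu : ContDiff ℝ 2 u) (z v : ℝ × ℝ) :
    HasFDerivAt (fun w => fderiv ℝ u w v) ((fderiv ℝ (fderiv ℝ u) z).flip v) z :=
  (((contDiff_fderiv_one hu).differentiable (by norm_num)) z).hasFDerivAt.clm_apply
    (hasFDerivAt_const v z) |>.congr_fderiv (by ext <;> simp)

lemma hasFDerivAt_ut (hu : ContDiff ℝ 2 u) (z : ℝ × ℝ) :
    HasFDerivAt (fun w : ℝ × ℝ => ut u w.1 w.2) ((fderiv ℝ (fderiv ℝ u) z).flip (1, 0)) z := by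
  simpa only [ut_eq_fderiv hu] using hasFDerivAt_fderiv_apply hu z (1, 0)

lemma hasFDerivAt_ux (hu : ContDiff ℝ 2 u) (z : ℝ × ℝ) :
    HasFDerivAt (fun w : ℝ × ℝ => ux u w.1 w.2) ((fderiv ℝ (fderiv ℝ u) z).flip (0, 1)) z := by
  simpa only [ux_eq_fderiv hu] using hasFDerivAt_fderiv_apply hu z (0, 1)

lemma continuous_ut (hu : ContDiff ℝ 2 u) : Continuous (fun z : ℝ × ℝ => ut u z.1 z.2) :=
  continuous_iff_continuousAt.2 fun z => (hasFDerivAt_ut hu z).continuousAt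

lemma continuous_ux (hu : ContDiff ℝ 2 u) : Continuous (fun z : ℝ × ℝ => ux u z.1 z.2) :=
  continuous_iff_continuousAt.2 fun z => (hasFDerivAt_ux hu z).continuousAt

lemma hasDerivAt_ut_time (hu : ContDiff ℝ 2 u) (t x : ℝ) :
    HasDerivAt (fun s => ut u s x) (utt u t x) t :=
  (hasFDerivAt_ut hu (t, x)).hasDerivAt_fst.differentiableAt.hasDerivAt

lemma hasDerivAt_ux_time (hu : ContDiff ℝ 2 u) (t x : ℝ) :
    HasDerivAt (fun s => ux u s x) (utx u t x) t :=
  (hasFDerivAt_ux hu (t, x)).hasDerivAt_fst.differentiableAt.hasDerivAt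

lemma hasDerivAt_ux_space (hu : ContDiff ℝ 2 u) (t x : ℝ) :
    HasDerivAt (fun y => ux u t y) (uxx u t x) x :=
  (hasFDerivAt_ux hu (t, x)).hasDerivAt_snd.differentiableAt.hasDerivAt

lemma hasDerivAt_ut_space (hu : ContDiff ℝ 2 u) (t x : ℝ) :
    HasDerivAt (fun y => ut u t y) (utx u t x) x := by
  have hsymm : IsSymmSndFDerivAt ℝ u (t, x) :=
    hu.contDiffAt.isSymmSndFDerivAt (by simp)
  have h1 := (hasFDerivAt_ux hu (t, x)).hasDerivAt_fst.deriv
  have h2 := (hasFDerivAt_ut hu (t, x)).hasDerivAt_snd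
  refine h2.congr_deriv ?_
  rw [utx, h1]
  simpa using hsymm (0, 1) (1, 0)

end Derivatives

/-! ### Momentum density and flux -/

/-- The Born–Infeld momentum density as a function of `a = ∂ₜu` and `b = ∂ₓu`. -/
noncomputable def momDensity (a b : ℝ) : ℝ := a * b / √(1 + b ^ 2 - a ^ 2)

/-- The Born–Infeld momentum flux, normalised to vanish at the origin. -/
noncomputable def momFlux (a b : ℝ) : ℝ := 1 - (1 - a ^ 2) / √(1 + b ^ 2 - a ^ 2)

lemma lagrangian_pos {a b : ℝ} (h : |b| + |a| ≤ 1 / 2) : 0 < 1 + b ^ 2 - a ^ 2 := by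
  have h1 := abs_nonneg b
  have h2 := abs_nonneg a
  nlinarith [sq_abs a, sq_nonneg b]

lemma sqrt_lagrangian_bounds {a b : ℝ} (h : |b| + |a| ≤ 1 / 2) :
    3 / 4 ≤ √(1 + b ^ 2 - a ^ 2) ∧ √(1 + b ^ 2 - a ^ 2) ≤ 9 / 8 := by
  have h1 := abs_nonneg b
  have h2 := abs_nonneg a
  constructor
  · apply Real.le_sqrt_of_sq_le
    nlinarith [sq_abs a, sq_nonneg b]
  · rw [Real.sqrt_le_left (by norm_num)]
    nlinarith [sq_abs b, sq_nonneg a]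

lemma abs_momDensity_le {a b : ℝ} (h : |b| + |a| ≤ 1 / 2) : |momDensity a b| ≤ a ^ 2 + b ^ 2 := by
  obtain ⟨hl, -⟩ := sqrt_lagrangian_bounds h
  have hW : 0 < √(1 + b ^ 2 - a ^ 2) := by linarith
  rw [momDensity, abs_div, abs_of_pos hW, div_le_iff₀ hW, abs_mul]
  nlinarith [sq_nonneg (|a| - |b|), sq_abs a, sq_abs b, sq_nonneg a, sq_nonneg b]

lemma le_momFlux {a b : ℝ} (h : |b| + |a| ≤ 1 / 2) : (a ^ 2 + b ^ 2) / 4 ≤ momFlux a b := by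
  obtain ⟨hl, hr⟩ := sqrt_lagrangian_bounds h
  have hsq : √(1 + b ^ 2 - a ^ 2) ^ 2 = 1 + b ^ 2 - a ^ 2 := Real.sq_sqrt (lagrangian_pos h).le
  rw [momFlux]
  set W := √(1 + b ^ 2 - a ^ 2)
  have hW : 0 < W := by linarith
  have hEq : 1 - (1 - a ^ 2) / W = (b ^ 2 + a ^ 2 * W) / (W * (1 + W)) := by
    field_simp
    linear_combination hsq
  rw [hEq, le_div_iff₀ (by positivity)]
  have hWW : W * (1 + W) ≤ 9 / 8 * (17 / 8) := by nlinarith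
  nlinarith [sq_nonneg a, sq_nonneg b, mul_nonneg (sq_nonneg a) (sub_nonneg.2 hl),
    mul_nonneg (add_nonneg (sq_nonneg a) (sq_nonneg b)) (sub_nonneg.2 hWW)]

section Curves

variable {a b : ℝ → ℝ} {a' b' s : ℝ}

lemma hasDerivAt_sqrt_lagrangian (ha : HasDerivAt a a' s) (hb : HasDerivAt b b' s)
    (h : |b s| + |a s| ≤ 1 / 2) :
    HasDerivAt (fun r => √(1 + b r ^ 2 - a r ^ 2))
      ((b s * b' - a s * a') / √(1 + b s ^ 2 - a s ^ 2)) s := by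
  have h1 := (((hb.pow 2).const_add 1).sub (ha.pow 2)).sqrt (lagrangian_pos h).ne'
  refine h1.congr_deriv ?_
  have := sqrt_lagrangian_bounds h
  have hW : √(1 + b s ^ 2 - a s ^ 2) ≠ 0 := by linarith
  simp only [Pi.sub_apply, Pi.pow_apply]
  field_simp
  ring

lemma hasDerivAt_momDensity (ha : HasDerivAt a a' s) (hb : HasDerivAt b b' s)
    (h : |b s| + |a s| ≤ 1 / 2) :
    HasDerivAt (fun r => momDensity (a r) (b r))
      ((a' * b s * (1 + b s ^ 2) + b' * a s * (1 - a s ^ 2)) / √(1 + b s ^ 2 - a s ^ 2) ^ 3) s := by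
  have hsq := Real.sq_sqrt (lagrangian_pos h).le
  have hl := (sqrt_lagrangian_bounds h).1
  have hW : √(1 + b s ^ 2 - a s ^ 2) ≠ 0 := by linarith
  refine ((ha.mul hb).div (hasDerivAt_sqrt_lagrangian ha hb h) hW).congr_deriv ?_
  simp only [Pi.mul_apply]
  set W := √(1 + b s ^ 2 - a s ^ 2)
  field_simp
  linear_combination (a' * b s + a s * b') * hsq

lemma hasDerivAt_momFlux (ha : HasDerivAt a a' s) (hb : HasDerivAt b b' s)
    (h : |b s| + |a s| ≤ 1 / 2) :
    HasDerivAt (fun r => momFlux (a r) (b r))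
      ((a' * a s * (1 - a s ^ 2 + 2 * b s ^ 2) + (1 - a s ^ 2) * b s * b') /
        √(1 + b s ^ 2 - a s ^ 2) ^ 3) s := by
  have hsq := Real.sq_sqrt (lagrangian_pos h).le
  have hl := (sqrt_lagrangian_bounds h).1
  have hW : √(1 + b s ^ 2 - a s ^ 2) ≠ 0 := by linarith
  refine ((((ha.pow 2).const_sub 1).div
    (hasDerivAt_sqrt_lagrangian ha hb h) hW).const_sub 1).congr_deriv ?_
  simp only [Pi.pow_apply]
  set W := √(1 + b s ^ 2 - a s ^ 2)
  field_simp
  norm_num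
  linear_combination (2 * a s * a') * hsq

end Curves

/-- The local conservation law for the momentum. -/
lemma exists_hasDerivAt_momentum {u : ℝ × ℝ → ℝ} (hu : ContDiff ℝ 2 u) (hBI : IsBISol u) {t x : ℝ}
    (h : |ux u t x| + |ut u t x| ≤ 1 / 2) :
    ∃ m, HasDerivAt (fun s => momDensity (ut u s x) (ux u s x)) m t ∧
      HasDerivAt (fun y => momFlux (ut u t y) (ux u t y)) m x := by
  refine ⟨_, hasDerivAt_momDensity (hasDerivAt_ut_time hu t x) (hasDerivAt_ux_time hu t x) h,
    (hasDerivAt_momFlux (hasDerivAt_ut_space hu t x) (hasDerivAt_ux_space hu t x)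
      h).congr_deriv ?_⟩
  congr 1
  linear_combination ux u t x * hBI t x

/-! ### The weight and the scaling function -/

lemma hasDerivAt_tanh' (x : ℝ) : HasDerivAt Real.tanh (sech x ^ 2) x := by
  have hc := (Real.cosh_pos x).ne'
  have := (Real.hasDerivAt_sinh x).div (Real.hasDerivAt_cosh x) hc
  refine (this.congr_of_eventuallyEq ?_).congr_deriv ?_
  · exact Eventually.of_forall fun y => Real.tanh_eq_sinh_div_cosh y
  · have := Real.cosh_sq x
    rw [sech]
    field_simp
    linarith

lemma continuous_sech : Continuous sech :=
  continuous_const.div Real.continuous_cosh fun x => (Real.cosh_pos x).ne'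

lemma sq_mul_sech_sq_le_one (y : ℝ) : y ^ 2 * sech y ^ 2 ≤ 1 := by
  have hc := Real.cosh_pos y
  rw [sech, div_pow, one_pow, mul_one_div, div_le_one (by positivity)]
  have hs : |y| ≤ |Real.sinh y| := by
    rw [Real.abs_sinh]
    exact Real.self_le_sinh_iff.2 (abs_nonneg y)
  have := sq_le_sq.2 hs
  rw [Real.cosh_sq]
  linarith

/-- The derivative of `lam C`. -/
noncomputable def lamDeriv (C t : ℝ) : ℝ := C * (Real.log t - 2) / Real.log t ^ 3

section Scaling

variable {C t : ℝ}

lemma lam_pos (hC : 0 < C) (ht : 1 < t) : 0 < lam C t := by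
  have := Real.log_pos ht
  rw [lam]
  positivity

lemma hasDerivAt_lam (ht : 1 < t) : HasDerivAt (lam C) (lamDeriv C t) t := by
  have hl := (Real.log_pos ht).ne'
  have ht0 : t ≠ 0 := by linarith
  refine (((hasDerivAt_id t).const_mul C).div ((Real.hasDerivAt_log ht0).pow 2)
    (pow_ne_zero 2 hl)).congr_deriv ?_
  simp only [lamDeriv, Pi.pow_apply, id]
  field_simp
  norm_num
  ring

lemma continuousAt_lamDeriv (ht : 1 < t) : ContinuousAt (lamDeriv C) t := by
  have hl := (Real.log_pos ht).ne'
  have := Real.continuousAt_log (x := t) (by linarith)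
  unfold lamDeriv
  exact (continuousAt_const.mul (this.sub continuousAt_const)).div (this.pow 3) (pow_ne_zero 3 hl)

lemma half_lt_log (ht : 2 ≤ t) : 1 / 2 < Real.log t := by
  have := Real.log_two_gt_d9
  have := Real.log_le_log (by norm_num) ht
  linarith

lemma lamDeriv_sq_div_lam_le (hC : 0 < C) (ht : 2 ≤ t) :
    1 / lam C t * lamDeriv C t ^ 2 ≤ 9 * C * (1 / (t * Real.log t ^ 2)) := by
  have hl := half_lt_log ht
  have hl0 : 0 < Real.log t := by linarith
  have ht0 : 0 < t := by linarith
  have h9 : (Real.log t - 2) ^ 2 ≤ 9 * Real.log t ^ 2 := by nlinarith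
  have hEq : 1 / lam C t * lamDeriv C t ^ 2 =
      C * (Real.log t - 2) ^ 2 / (t * Real.log t ^ 4) := by
    rw [lam, lamDeriv]
    field_simp
  have hEq' : 9 * C * (1 / (t * Real.log t ^ 2)) =
      C * (9 * Real.log t ^ 2) / (t * Real.log t ^ 4) := by
    field_simp
  rw [hEq, hEq']
  gcongr

lemma continuousOn_one_div_mul_log_sq (T : ℝ) :
    ContinuousOn (fun t => 1 / (t * Real.log t ^ 2)) (Set.Icc 2 T) := by
  intro t ht
  have h1 : t ≠ 0 := by linarith [ht.1]
  have hl := half_lt_log ht.1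
  have h2 : t * Real.log t ^ 2 ≠ 0 := mul_ne_zero h1 (pow_ne_zero 2 (by linarith))
  exact (continuousAt_const.div (continuousAt_id.mul ((Real.continuousAt_log h1).pow 2))
    h2).continuousWithinAt

lemma integral_one_div_mul_log_sq_le {T : ℝ} (hT : 2 ≤ T) :
    ∫ t in (2 : ℝ)..T, 1 / (t * Real.log t ^ 2) ≤ 2 := by
  have hderiv : ∀ t ∈ Set.uIcc 2 T,
      HasDerivAt (fun s => -(Real.log s)⁻¹) (1 / (t * Real.log t ^ 2)) t := by
    intro t ht
    rw [Set.uIcc_of_le hT] at ht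
    have hl := half_lt_log ht.1
    have ht0 : t ≠ 0 := by linarith [ht.1]
    have hl0 : Real.log t ≠ 0 := by linarith
    refine ((Real.hasDerivAt_log ht0).inv hl0).neg.congr_deriv ?_
    field_simp
  rw [intervalIntegral.integral_eq_sub_of_hasDerivAt hderiv
    ((Set.uIcc_of_le hT ▸ continuousOn_one_div_mul_log_sq T).intervalIntegrable)]
  have h2 := half_lt_log le_rfl
  have hT0 := half_lt_log hT
  have h1 : (Real.log 2)⁻¹ ≤ 2 := by
    rw [inv_le_comm₀ (by linarith) (by norm_num)]
    linarith
  have h3 : 0 < (Real.log T)⁻¹ := inv_pos.2 (by linarith)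
  linarith

end Scaling

/-! ### The virial identity -/

/-- The localised energy density. -/
noncomputable def localEnergy (C : ℝ) (u : ℝ × ℝ → ℝ) (t x : ℝ) : ℝ :=
  (1 / lam C t) * (sech (x / lam C t)) ^ 2 * ((ut u t x) ^ 2 + (ux u t x) ^ 2)

/-- Minus the time derivative of the virial density, up to an exact space derivative. -/
noncomputable def virialDensity (C : ℝ) (u : ℝ × ℝ → ℝ) (t x : ℝ) : ℝ :=
  1 / lam C t * (sech (x / lam C t) ^ 2 * momFlux (ut u t x) (ux u t x) +
    lamDeriv C t * (x / lam C t) * sech (x / lam C t) ^ 2 * momDensity (ut u t x) (ux u t x))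

lemma localEnergy_le_virialDensity {C : ℝ} {u : ℝ × ℝ → ℝ} {t x : ℝ} (hC : 0 < C) (ht : 2 ≤ t)
    (h : |ux u t x| + |ut u t x| ≤ 1 / 2) :
    localEnergy C u t x / 8 ≤ virialDensity C u t x +
      18 * C * (1 / (t * Real.log t ^ 2)) * ((ux u t x) ^ 2 + (ut u t x) ^ 2) := by
  have hl := lam_pos hC (show 1 < t by linarith)
  have hB := lamDeriv_sq_div_lam_le hC ht
  have hp := abs_momDensity_le h
  have hq := le_momFlux h
  have hy := sq_mul_sech_sq_le_one (x / lam C t)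
  rw [localEnergy, virialDensity]
  set y := x / lam C t
  set s := sech y
  set d := lamDeriv C t
  set p := momDensity (ut u t x) (ux u t x)
  set q := momFlux (ut u t x) (ux u t x)
  have hS : 0 ≤ ut u t x ^ 2 + ux u t x ^ 2 := by positivity
  have hcomm : ux u t x ^ 2 + ut u t x ^ 2 = ut u t x ^ 2 + ux u t x ^ 2 := add_comm _ _
  rw [hcomm]
  set S := ut u t x ^ 2 + ux u t x ^ 2
  have h1 : s ^ 2 * (S / 4) ≤ s ^ 2 * q := mul_le_mul_of_nonneg_left hq (sq_nonneg s)
  have h2 : |d * y| ≤ 1 / 8 + 2 * (d * y) ^ 2 := by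
    rw [← sq_abs (d * y)]
    nlinarith [sq_nonneg (|d * y| - 1 / 4)]
  have h3 : -(s ^ 2 * (1 / 8 + 2 * (d * y) ^ 2) * S) ≤ d * y * s ^ 2 * p := by
    have : |d * y * s ^ 2 * p| ≤ s ^ 2 * (1 / 8 + 2 * (d * y) ^ 2) * S := by
      rw [abs_mul, abs_mul (d * y), abs_of_nonneg (sq_nonneg s), mul_comm |d * y|]
      gcongr
    exact (abs_le.1 this).1
  have h4 : d ^ 2 * (y ^ 2 * s ^ 2) * S ≤ d ^ 2 * 1 * S := by gcongr
  have h5 : s ^ 2 * S / 8 ≤ s ^ 2 * q + d * y * s ^ 2 * p + 2 * d ^ 2 * S := by nlinarith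
  have h6 := mul_le_mul_of_nonneg_left h5 (one_div_pos.2 hl).le
  have h7 := mul_le_mul_of_nonneg_right hB hS
  linarith

lemma momFlux_zero : momFlux 0 0 = 0 := by simp [momFlux]

section Virial

variable {C : ℝ} {u : ℝ × ℝ → ℝ}

lemma differentiableAt_scaled_tanh (hC : 0 < C) {z : ℝ × ℝ} (hz : 1 < z.1) :
    DifferentiableAt ℝ (fun w : ℝ × ℝ => Real.tanh (w.2 / lam C w.1)) z := by
  have h1 : DifferentiableAt ℝ (fun w : ℝ × ℝ => lam C w.1) z :=
    (hasDerivAt_lam hz).differentiableAt.comp z differentiableAt_fst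
  have h2 : DifferentiableAt ℝ (fun w : ℝ × ℝ => w.2 / lam C w.1) z :=
    by simpa only [div_eq_mul_inv] using
      differentiableAt_snd.fun_mul (h1.fun_inv (lam_pos hC hz).ne')
  exact (hasDerivAt_tanh' _).differentiableAt.comp z h2

lemma differentiableAt_inv_sqrt_lagrangian (hu : ContDiff ℝ 2 u)
    (h : ∀ t x : ℝ, |ux u t x| + |ut u t x| ≤ 1 / 2) (z : ℝ × ℝ) :
    DifferentiableAt ℝ
      (fun w : ℝ × ℝ => (√(1 + ux u w.1 w.2 ^ 2 - ut u w.1 w.2 ^ 2))⁻¹) z := by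
  have ha := (hasFDerivAt_ut hu z).differentiableAt
  have hb := (hasFDerivAt_ux hu z).differentiableAt
  have hl := (sqrt_lagrangian_bounds (h z.1 z.2)).1
  exact DifferentiableAt.inv ((((hb.fun_pow 2).const_add 1).fun_sub (ha.fun_pow 2)).sqrt
    (lagrangian_pos (h z.1 z.2)).ne') (by linarith)

lemma differentiableAt_momDensity (hu : ContDiff ℝ 2 u)
    (h : ∀ t x : ℝ, |ux u t x| + |ut u t x| ≤ 1 / 2) (z : ℝ × ℝ) :
    DifferentiableAt ℝ (fun w : ℝ × ℝ => momDensity (ut u w.1 w.2) (ux u w.1 w.2)) z := by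
  have ha := (hasFDerivAt_ut hu z).differentiableAt
  have hb := (hasFDerivAt_ux hu z).differentiableAt
  simpa only [momDensity, div_eq_mul_inv] using
    (ha.fun_mul hb).fun_mul (differentiableAt_inv_sqrt_lagrangian hu h z)

lemma differentiableAt_momFlux (hu : ContDiff ℝ 2 u)
    (h : ∀ t x : ℝ, |ux u t x| + |ut u t x| ≤ 1 / 2) (z : ℝ × ℝ) :
    DifferentiableAt ℝ (fun w : ℝ × ℝ => momFlux (ut u w.1 w.2) (ux u w.1 w.2)) z := by
  have ha := (hasFDerivAt_ut hu z).differentiableAt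
  simpa only [momFlux, div_eq_mul_inv] using (((ha.fun_pow 2).const_sub 1).fun_mul
    (differentiableAt_inv_sqrt_lagrangian hu h z)).const_sub 1

lemma continuousAt_lam_fst {z : ℝ × ℝ} (hz : 1 < z.1) :
    ContinuousAt (fun w : ℝ × ℝ => lam C w.1) z :=
  (hasDerivAt_lam hz).continuousAt.comp continuousAt_fst

lemma continuousAt_localEnergy (hC : 0 < C) (hu : ContDiff ℝ 2 u) {z : ℝ × ℝ} (hz : 1 < z.1) :
    ContinuousAt (fun w : ℝ × ℝ => localEnergy C u w.1 w.2) z := by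
  have hl := continuousAt_lam_fst (C := C) hz
  have hne := (lam_pos hC hz).ne'
  have hy : ContinuousAt (fun w : ℝ × ℝ => w.2 / lam C w.1) z := continuousAt_snd.div hl hne
  have hs : ContinuousAt (fun w : ℝ × ℝ => sech (w.2 / lam C w.1)) z :=
    continuous_sech.continuousAt.comp hy
  exact ((continuousAt_const.div hl hne).mul (hs.pow 2)).mul
    (((continuous_ut hu).continuousAt.pow 2).add ((continuous_ux hu).continuousAt.pow 2))

lemma continuousAt_virialDensity (hC : 0 < C) (hu : ContDiff ℝ 2 u)
    (h : ∀ t x : ℝ, |ux u t x| + |ut u t x| ≤ 1 / 2) {z : ℝ × ℝ} (hz : 1 < z.1) :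
    ContinuousAt (fun w : ℝ × ℝ => virialDensity C u w.1 w.2) z := by
  have hl := continuousAt_lam_fst (C := C) hz
  have hne := (lam_pos hC hz).ne'
  have hy : ContinuousAt (fun w : ℝ × ℝ => w.2 / lam C w.1) z := continuousAt_snd.div hl hne
  have hs : ContinuousAt (fun w : ℝ × ℝ => sech (w.2 / lam C w.1)) z :=
    continuous_sech.continuousAt.comp hy
  have hd : ContinuousAt (fun w : ℝ × ℝ => lamDeriv C w.1) z :=
    (continuousAt_lamDeriv hz).comp continuousAt_fst
  exact (continuousAt_const.div hl hne).mul
    (((hs.pow 2).mul (differentiableAt_momFlux hu h z).continuousAt).add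
      (((hd.mul hy).mul (hs.pow 2)).mul (differentiableAt_momDensity hu h z).continuousAt))

lemma fderiv_add_fderiv_eq_neg_virialDensity (hC : 0 < C) (hu : ContDiff ℝ 2 u) (hBI : IsBISol u)
    (h : ∀ t x : ℝ, |ux u t x| + |ut u t x| ≤ 1 / 2) {t x : ℝ} (ht : 1 < t)
    {F' G' : ℝ × ℝ →L[ℝ] ℝ}
    (hF : HasFDerivAt (fun w : ℝ × ℝ => Real.tanh (w.2 / lam C w.1) *
      momDensity (ut u w.1 w.2) (ux u w.1 w.2)) F' (t, x))
    (hG : HasFDerivAt (fun w : ℝ × ℝ => -(Real.tanh (w.2 / lam C w.1) *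
      momFlux (ut u w.1 w.2) (ux u w.1 w.2))) G' (t, x)) :
    F' (1, 0) + G' (0, 1) = -virialDensity C u t x := by
  obtain ⟨m, hm1, hm2⟩ := exists_hasDerivAt_momentum hu hBI (h t x)
  have hl := lam_pos hC ht
  have hy1 : HasDerivAt (fun s => x / lam C s) (-(x * lamDeriv C t) / lam C t ^ 2) t := by
    refine ((hasDerivAt_const t x).div (hasDerivAt_lam ht) hl.ne').congr_deriv ?_
    simp
  have hy2 : HasDerivAt (fun y => y / lam C t) (1 / lam C t) x :=
    (hasDerivAt_id x).div_const _
  have h1 := hF.hasDerivAt_fst.unique (((hasDerivAt_tanh' _).comp t hy1).mul hm1)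
  have h2 := hG.hasDerivAt_snd.unique (((hasDerivAt_tanh' _).comp x hy2).mul hm2).neg
  rw [h1, h2, virialDensity]
  simp only [Function.comp_apply]
  field_simp
  ring

lemma abs_integral_tanh_mul_momDensity_le {ε R t : ℝ} (hR : 0 ≤ R)
    (hu : ContDiff ℝ 2 u) (h : ∀ t x : ℝ, |ux u t x| + |ut u t x| ≤ 1 / 2)
    (hE : ∫ x in (-R)..R, ((ux u t x) ^ 2 + (ut u t x) ^ 2) ≤ ε ^ 2) :
    |∫ x in (-R)..R, Real.tanh (x / lam C t) * momDensity (ut u t x) (ux u t x)| ≤ ε ^ 2 := by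
  have hc : Continuous fun x => (ux u t x) ^ 2 + (ut u t x) ^ 2 :=
    (((continuous_ux hu).comp (Continuous.prodMk_right t)).pow 2).add
      (((continuous_ut hu).comp (Continuous.prodMk_right t)).pow 2)
  refine (intervalIntegral.norm_integral_le_of_norm_le (by linarith)
    (f := fun x => Real.tanh (x / lam C t) * momDensity (ut u t x) (ux u t x))
    (Eventually.of_forall fun x _ => ?_) (hc.intervalIntegrable (-R) R)).trans hE
  rw [norm_mul, Real.norm_eq_abs, Real.norm_eq_abs]
  have h1 := abs_momDensity_le (h t x)
  have h2 := (Real.abs_tanh_lt_one (x / lam C t)).le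
  have h3 := abs_nonneg (momDensity (ut u t x) (ux u t x))
  nlinarith

lemma integral_virialDensity_le {ε R T : ℝ} (hC : 0 < C) (hT : 2 ≤ T) (hR : 0 ≤ R)
    (hu : ContDiff ℝ 2 u) (hBI : IsBISol u)
    (h : ∀ t x : ℝ, |ux u t x| + |ut u t x| ≤ 1 / 2)
    (hE : ∀ t ∈ Set.Icc 2 T, ∫ x in (-R)..R, ((ux u t x) ^ 2 + (ut u t x) ^ 2) ≤ ε ^ 2)
    (hsupp : ∀ t ∈ Set.Icc 2 T, ∀ x, R ≤ |x| → ux u t x = 0 ∧ ut u t x = 0) :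
    ∫ t in (2 : ℝ)..T, ∫ x in (-R)..R, virialDensity C u t x ≤ 2 * ε ^ 2 := by
  set F : ℝ × ℝ → ℝ := fun w => Real.tanh (w.2 / lam C w.1) *
    momDensity (ut u w.1 w.2) (ux u w.1 w.2) with hFdef
  set G : ℝ × ℝ → ℝ := fun w => -(Real.tanh (w.2 / lam C w.1) *
    momFlux (ut u w.1 w.2) (ux u w.1 w.2)) with hGdef
  have hF : ∀ z : ℝ × ℝ, 1 < z.1 → DifferentiableAt ℝ F z := fun z hz =>
    (differentiableAt_scaled_tanh hC hz).mul (differentiableAt_momDensity hu h z)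
  have hG : ∀ z : ℝ × ℝ, 1 < z.1 → DifferentiableAt ℝ G z := fun z hz =>
    ((differentiableAt_scaled_tanh hC hz).mul (differentiableAt_momFlux hu h z)).neg
  have hmem : ∀ z ∈ Set.uIcc 2 T ×ˢ Set.uIcc (-R) R, 1 < z.1 := by
    rintro z ⟨hz, -⟩
    rw [Set.uIcc_of_le hT] at hz
    linarith [hz.1]
  have hmem' : ∀ z ∈ Set.Ioo (min 2 T) (max 2 T) ×ˢ Set.Ioo (min (-R) R) (max (-R) R) \ ∅,
      1 < z.1 := by
    rintro z ⟨⟨hz, -⟩, -⟩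
    rw [min_eq_left hT] at hz
    linarith [hz.1]
  have hdiv : ∀ t x : ℝ, 1 < t →
      fderiv ℝ F (t, x) (1, 0) + fderiv ℝ G (t, x) (0, 1) = -virialDensity C u t x :=
    fun t x ht => fderiv_add_fderiv_eq_neg_virialDensity hC hu hBI h ht
      (hF (t, x) ht).hasFDerivAt (hG (t, x) ht).hasFDerivAt
  have hint : IntegrableOn (fun z => fderiv ℝ F z (1, 0) + fderiv ℝ G z (0, 1))
      (Set.uIcc 2 T ×ˢ Set.uIcc (-R) R) := by
    refine IntegrableOn.congr_fun (f := fun z => -virialDensity C u z.1 z.2) ?_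
      (fun z hz => (hdiv z.1 z.2 (hmem z hz)).symm)
      (measurableSet_uIcc.prod measurableSet_uIcc)
    refine ContinuousOn.integrableOn_compact (isCompact_uIcc.prod isCompact_uIcc) ?_
    exact fun z hz =>
      (continuousAt_virialDensity hC hu h (hmem z hz)).neg.continuousWithinAt
  have hgreen := integral2_divergence_prod_of_hasFDerivAt_off_countable F G
    (fderiv ℝ F) (fderiv ℝ G) 2 (-R) T R ∅ Set.countable_empty
    (fun z hz => (hF z (hmem z hz)).continuousAt.continuousWithinAt)
    (fun z hz => (hG z (hmem z hz)).continuousAt.continuousWithinAt)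
    (fun z hz => (hF z (hmem' z hz)).hasFDerivAt) (fun z hz => (hG z (hmem' z hz)).hasFDerivAt)
    hint
  have hleft : ∫ t in (2 : ℝ)..T, ∫ x in (-R)..R,
      (fderiv ℝ F (t, x) (1, 0) + fderiv ℝ G (t, x) (0, 1)) =
      -∫ t in (2 : ℝ)..T, ∫ x in (-R)..R, virialDensity C u t x := by
    rw [← intervalIntegral.integral_neg]
    refine intervalIntegral.integral_congr fun t ht => ?_
    rw [Set.uIcc_of_le hT] at ht
    simp only [← intervalIntegral.integral_neg]
    exact intervalIntegral.integral_congr fun x _ => hdiv t x (by linarith [ht.1])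
  have hbdry : ∀ x : ℝ, R ≤ |x| → ∫ t in (2 : ℝ)..T, G (t, x) = 0 := by
    intro x hx
    rw [← intervalIntegral.integral_zero (a := (2 : ℝ)) (b := T)]
    refine intervalIntegral.integral_congr fun t ht => ?_
    rw [Set.uIcc_of_le hT] at ht
    obtain ⟨h1, h2⟩ := hsupp t ht x hx
    simp only [hGdef, h1, h2, momFlux_zero, mul_zero, neg_zero]
  rw [hleft, hbdry R (le_abs_self R), hbdry (-R) (abs_neg R ▸ le_abs_self R)] at hgreen
  have hI2 := abs_le.1 (abs_integral_tanh_mul_momDensity_le (C := C) hR hu h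
    (hE 2 (Set.left_mem_Icc.2 hT)))
  have hIT := abs_le.1 (abs_integral_tanh_mul_momDensity_le (C := C) hR hu h
    (hE T (Set.right_mem_Icc.2 hT)))
  simp only [hFdef] at hgreen
  linarith [hI2.2, hIT.1]

lemma intervalIntegrable_integral_of_continuousAt {f : ℝ → ℝ → ℝ} {a b c d : ℝ} (hab : a ≤ b)
    (hcd : c ≤ d) (hf : ∀ t x, a ≤ t → ContinuousAt (fun z : ℝ × ℝ => f z.1 z.2) (t, x)) :
    IntervalIntegrable (fun t => ∫ x in c..d, f t x) volume a b := by
  have h1 : IntegrableOn (fun z : ℝ × ℝ => f z.1 z.2) (Set.Icc a b ×ˢ Set.Icc c d)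
      (volume.prod volume) :=
    ContinuousOn.integrableOn_compact (isCompact_Icc.prod isCompact_Icc)
      fun z hz => (hf z.1 z.2 hz.1.1).continuousWithinAt
  rw [IntegrableOn, ← Measure.prod_restrict] at h1
  rw [intervalIntegrable_iff_integrableOn_Icc_of_le hab]
  simpa only [IntegrableOn, intervalIntegral.integral_of_le hcd, integral_Icc_eq_integral_Ioc]
    using h1.integral_prod_left

lemma integral_localEnergy_le {ε R T : ℝ} (hC : 0 < C) (hT : 2 ≤ T) (hR : 0 ≤ R)
    (hu : ContDiff ℝ 2 u) (hBI : IsBISol u)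
    (h : ∀ t x : ℝ, |ux u t x| + |ut u t x| ≤ 1 / 2)
    (hE : ∀ t ∈ Set.Icc 2 T, ∫ x in (-R)..R, ((ux u t x) ^ 2 + (ut u t x) ^ 2) ≤ ε ^ 2)
    (hsupp : ∀ t ∈ Set.Icc 2 T, ∀ x, R ≤ |x| → ux u t x = 0 ∧ ut u t x = 0) :
    ∫ t in (2 : ℝ)..T, ∫ x in (-R)..R, localEnergy C u t x ≤ (16 + 288 * C) * ε ^ 2 := by
  have hRR : -R ≤ R := by linarith
  have hslice : ∀ t : ℝ, Continuous fun x : ℝ => ((t, x) : ℝ × ℝ) := Continuous.prodMk_right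
  have hintE := intervalIntegrable_integral_of_continuousAt hT hRR
    fun t x ht => continuousAt_localEnergy hC hu (z := (t, x)) (show 1 < t by linarith)
  have hintV := intervalIntegrable_integral_of_continuousAt hT hRR
    fun t x ht => continuousAt_virialDensity hC hu h (z := (t, x)) (show 1 < t by linarith)
  have hintL : IntervalIntegrable (fun t => 1 / (t * Real.log t ^ 2)) volume 2 T :=
    (Set.uIcc_of_le hT ▸ continuousOn_one_div_mul_log_sq T).intervalIntegrable
  have hmono : ∫ t in (2 : ℝ)..T, (∫ x in (-R)..R, localEnergy C u t x) / 8 ≤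
      ∫ t in (2 : ℝ)..T, ((∫ x in (-R)..R, virialDensity C u t x) +
        18 * C * ε ^ 2 * (1 / (t * Real.log t ^ 2))) := by
    refine intervalIntegral.integral_mono_on hT (hintE.div_const 8)
      (hintV.add (hintL.const_mul _)) fun t ht => ?_
    have ht1 : 1 < t := by linarith [ht.1]
    have hcE : Continuous fun x => localEnergy C u t x := continuous_iff_continuousAt.2 fun x =>
      (continuousAt_localEnergy hC hu (z := (t, x)) ht1).comp (hslice t).continuousAt
    have hcV : Continuous fun x => virialDensity C u t x := continuous_iff_continuousAt.2 fun x =>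
      (continuousAt_virialDensity hC hu h (z := (t, x)) ht1).comp (hslice t).continuousAt
    have hcS : Continuous fun x => (ux u t x) ^ 2 + (ut u t x) ^ 2 :=
      (((continuous_ux hu).comp (hslice t)).pow 2).add (((continuous_ut hu).comp (hslice t)).pow 2)
    have hpt := intervalIntegral.integral_mono_on hRR
      ((hcE.div_const 8).intervalIntegrable (μ := volume) (-R) R)
      ((hcV.fun_add (hcS.const_mul
        (18 * C * (1 / (t * Real.log t ^ 2))))).intervalIntegrable (-R) R)
      fun x _ => localEnergy_le_virialDensity hC ht.1 (h t x)
    rw [intervalIntegral.integral_div, intervalIntegral.integral_add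
      (hcV.intervalIntegrable (μ := volume) _ _) ((hcS.const_mul _).intervalIntegrable _ _),
      intervalIntegral.integral_const_mul] at hpt
    have hpos : 0 ≤ 18 * C * (1 / (t * Real.log t ^ 2)) := by
      have : 0 < t := by linarith
      positivity
    have := mul_le_mul_of_nonneg_left (hE t ht) hpos
    linarith
  rw [intervalIntegral.integral_div, intervalIntegral.integral_add hintV (hintL.const_mul _),
    intervalIntegral.integral_const_mul] at hmono
  have hV := integral_virialDensity_le hC hT hR hu hBI h hE hsupp
  have hL := mul_le_mul_of_nonneg_left (integral_one_div_mul_log_sq_le hT)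
    (show 0 ≤ 18 * C * ε ^ 2 by positivity)
  linarith

lemma lintegral_Ioc_localEnergy_eq {R T : ℝ} (hC : 0 < C) (hT : 2 ≤ T) (hR : 0 < R)
    (hu : ContDiff ℝ 2 u)
    (hsupp : ∀ t ∈ Set.Icc 2 T, ∀ x, R ≤ |x| → ux u t x = 0 ∧ ut u t x = 0) :
    ∫⁻ t in Set.Ioc 2 T, ∫⁻ x : ℝ, ENNReal.ofReal (localEnergy C u t x) =
      ENNReal.ofReal (∫ t in (2 : ℝ)..T, ∫ x in (-R)..R, localEnergy C u t x) := by
  have hRR : -R ≤ R := by linarith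
  have hnn : ∀ t ∈ Set.Ioc 2 T, ∀ x, 0 ≤ localEnergy C u t x := by
    intro t ht x
    have := lam_pos hC (show 1 < t by linarith [ht.1])
    unfold localEnergy
    positivity
  have hintE := intervalIntegrable_integral_of_continuousAt hT hRR
    fun t x ht => continuousAt_localEnergy hC hu (z := (t, x)) (show 1 < t by linarith)
  rw [intervalIntegral.integral_of_le hT, ofReal_integral_eq_lintegral_ofReal hintE.1]
  · refine setLIntegral_congr_fun measurableSet_Ioc fun t ht => ?_
    have hc : Continuous fun x => localEnergy C u t x := continuous_iff_continuousAt.2 fun x =>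
      (continuousAt_localEnergy hC hu (z := (t, x)) (show 1 < t by linarith [ht.1])).comp
        (Continuous.prodMk_right t).continuousAt
    rw [intervalIntegral.integral_of_le hRR, ofReal_integral_eq_lintegral_ofReal
      (hc.intervalIntegrable _ _).1 (Eventually.of_forall (hnn t ht)),
      setLIntegral_eq_of_support_subset]
    intro x hx
    by_contra hx'
    have hxR : R ≤ |x| := by
      rw [Set.mem_Ioc, not_and_or, not_lt, not_le] at hx'
      rw [le_abs]
      rcases hx' with h | h
      · exact Or.inr (by linarith)
      · exact Or.inl h.le
    obtain ⟨h1, h2⟩ := hsupp t (Set.Ioc_subset_Icc_self ht) x hxR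
    exact hx (by simp [localEnergy, h1, h2])
  · refine (ae_restrict_iff' measurableSet_Ioc).2 (Eventually.of_forall fun t ht => ?_)
    exact intervalIntegral.integral_nonneg hRR fun x _ => hnn t ht x

end Virial

lemma setLIntegral_Ioi_le_of_forall_Ioc {f : ℝ → ENNReal} {a : ℝ} {c : ENNReal}
    (h : ∀ T, a ≤ T → ∫⁻ t in Set.Ioc a T, f t ≤ c) : ∫⁻ t in Set.Ioi a, f t ≤ c := by
  have hU : Set.Ioi a = ⋃ n : ℕ, Set.Ioc a (a + n) := by
    ext t
    simp only [Set.mem_Ioi, Set.mem_iUnion, Set.mem_Ioc]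
    refine ⟨fun ht => ?_, fun ⟨_, ht, _⟩ => ht⟩
    obtain ⟨n, hn⟩ := exists_nat_ge (t - a)
    exact ⟨n, ht, by linarith⟩
  have hmono : Monotone fun n : ℕ => Set.Ioc a (a + n) := fun m n hmn =>
    Set.Ioc_subset_Ioc_right (by gcongr)
  rw [hU, setLIntegral_iUnion_of_directed _ hmono.directed_le]
  exact iSup_le fun n => h _ (by linarith [n.cast_nonneg (α := ℝ)])

/-- Averaged estimate (Lemma 2.3, (Integra)): there is `K > 0` depending only on `C` such that
`∫_2^∞ (1/λ(t)) ∫ sech²(x/λ(t)) ((∂ₜu)² + (∂ₓu)²) dx dt ≤ K ε²`. -/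
theorem integrated_virial_estimate :
    ∃ ε₀ : ℝ, 0 < ε₀ ∧ ∀ C : ℝ, 0 < C → ∃ K : ℝ, 0 < K ∧ ∀ ε : ℝ, 0 < ε → ε ≤ ε₀ →
    ∀ u : ℝ × ℝ → ℝ, ContDiff ℝ 2 u → IsBISol u →
    (∀ t x : ℝ, |ux u t x| + |ut u t x| ≤ ε) →
    (∀ t : ℝ, ∫ x : ℝ, ((ux u t x) ^ 2 + (ut u t x) ^ 2) ≤ ε ^ 2) →
    (∀ T : ℝ, ∃ R : ℝ, ∀ t x : ℝ, |t| ≤ T → R ≤ |x| → ux u t x = 0 ∧ ut u t x = 0) →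
      ∫⁻ t in Set.Ioi (2 : ℝ), ∫⁻ x : ℝ, ENNReal.ofReal
          ((1 / lam C t) * (sech (x / lam C t)) ^ 2 * ((ut u t x) ^ 2 + (ux u t x) ^ 2))
        ≤ ENNReal.ofReal (K * ε ^ 2) := by
  refine ⟨1 / 2, by norm_num, fun C hC => ⟨16 + 288 * C, by positivity, ?_⟩⟩
  intro ε _ hε u hu hBI hsmall henergy hsupp
  have h : ∀ t x : ℝ, |ux u t x| + |ut u t x| ≤ 1 / 2 := fun t x => (hsmall t x).trans hε
  refine setLIntegral_Ioi_le_of_forall_Ioc fun T hT => ?_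
  obtain ⟨R₀, hR₀⟩ := hsupp T
  set R := max R₀ 1
  have hR : 0 < R := lt_max_of_lt_right one_pos
  have hsupp' : ∀ t ∈ Set.Icc 2 T, ∀ x, R ≤ |x| → ux u t x = 0 ∧ ut u t x = 0 := by
    intro t ht x hx
    refine hR₀ t x ?_ ((le_max_left _ _).trans hx)
    rw [abs_of_nonneg (by linarith [ht.1])]
    exact ht.2
  have hE : ∀ t ∈ Set.Icc 2 T,
      ∫ x in (-R)..R, ((ux u t x) ^ 2 + (ut u t x) ^ 2) ≤ ε ^ 2 := by
    intro t ht
    rw [intervalIntegral.integral_eq_integral_of_support_subset]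
    · exact henergy t
    intro x hx
    by_contra hx'
    have hxR : R ≤ |x| := by
      rw [Set.mem_Ioc, not_and_or, not_lt, not_le] at hx'
      rw [le_abs]
      rcases hx' with h | h
      · exact Or.inr (by linarith)
      · exact Or.inl h.le
    obtain ⟨h1, h2⟩ := hsupp' t ht x hxR
    exact hx (by simp [h1, h2])
  exact (lintegral_Ioc_localEnergy_eq hC hT hR hu hsupp').trans_le
    (ENNReal.ofReal_le_ofReal (integral_localEnergy_le hC hT hR.le hu hBI h hE hsupp'))
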